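/- arXiv:2112.07187 — 6 statements merged into one kernel-verified Lean document; each statement's English description precedes it below -/
import Mathlib

section
/- Let (Ω, F, P) be a probability space with a filtration (F_k)_{k∈ℕ} and let (Y_k)_{k∈ℕ} be a nonnegative real-valued stochastic process adapted to (F_k) such that each Y_k is integrable. Let γ, λ > 0 with λ > γ, let 0 < κ < 1, let ψ ≥ 0, and assume λ ≥ ψ/(1−κ). Suppose Y_0 ≤ γ almost surely, and for every k ∈ ℕ the conditional expectation satisfies E[Y_{k+1} | F_k] ≤ κ·Y_k + ψ almost surely. Then for every finite horizon T ∈ ℕ, P(∃ k ∈ ℕ, k < T and Y_k ≥ λ) ≤ 1 − (1 − γ/λ)(1 − ψ/λ)^T. -/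
open MeasureTheory ProbabilityTheory

lemma measurableSet_forall_le_lt {Ω : Type*} {m0 : MeasurableSpace Ω}
    (ℱ : Filtration ℕ m0) {Y : ℕ → Ω → ℝ} (hY : Adapted ℱ Y) (c : ℝ) (k : ℕ) :
    MeasurableSet[ℱ k] {ω | ∀ j ≤ k, Y j ω < c} := by
  simp only [Set.ofPred_forall]
  exact MeasurableSet.iInter fun j ↦ MeasurableSet.iInter fun hj ↦
    ((hY j).mono (ℱ.mono hj) le_rfl) measurableSet_Iio

/-- If the conditional drift of `Y` gives `a * (c - Y k) ≤ c - 𝔼[Y (k + 1) | ℱ k]`, then the mean of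
`c - Y k` on the event of staying below `c` decays at most geometrically with ratio `a`. -/
lemma mul_setIntegral_sub_le_setIntegral_sub_succ
    {Ω : Type*} {m0 : MeasurableSpace Ω} {μ : Measure Ω} [IsProbabilityMeasure μ]
    (ℱ : Filtration ℕ m0) {Y : ℕ → Ω → ℝ} (hY : Adapted ℱ Y) (hint : ∀ k, Integrable (Y k) μ)
    {a c : ℝ} {k : ℕ} (h : ∀ᵐ ω ∂μ, a * (c - Y k ω) ≤ c - (μ[Y (k + 1) | ℱ k]) ω) :
    a * ∫ ω in {ω | ∀ j ≤ k, Y j ω < c}, (c - Y k ω) ∂μ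
      ≤ ∫ ω in {ω | ∀ j ≤ k + 1, Y j ω < c}, (c - Y (k + 1) ω) ∂μ := by
  have hB k := measurableSet_forall_le_lt ℱ hY c k
  have hi k : Integrable (fun ω ↦ c - Y k ω) μ := (integrable_const c).sub (hint k)
  have hce : Integrable (fun ω ↦ c - (μ[Y (k + 1) | ℱ k]) ω) μ :=
    (integrable_const c).sub integrable_condExp
  calc a * ∫ ω in {ω | ∀ j ≤ k, Y j ω < c}, (c - Y k ω) ∂μ
      = ∫ ω in {ω | ∀ j ≤ k, Y j ω < c}, a * (c - Y k ω) ∂μ := (integral_const_mul _ _).symm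
    _ ≤ ∫ ω in {ω | ∀ j ≤ k, Y j ω < c}, (c - (μ[Y (k + 1) | ℱ k]) ω) ∂μ :=
        setIntegral_mono_ae ((hi k).const_mul a).integrableOn hce.integrableOn h
    _ = ∫ ω in {ω | ∀ j ≤ k, Y j ω < c}, (c - Y (k + 1) ω) ∂μ := by
        rw [integral_sub (integrable_const c) integrable_condExp.integrableOn,
          integral_sub (integrable_const c) (hint (k + 1)).integrableOn,
          setIntegral_condExp (ℱ.le k) (hint (k + 1)) (hB k)]
    _ ≤ ∫ ω in {ω | ∀ j ≤ k + 1, Y j ω < c}, (c - Y (k + 1) ω) ∂μ := by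
        rw [← integral_indicator (ℱ.le k _ (hB k)),
          ← integral_indicator (ℱ.le (k + 1) _ (hB (k + 1)))]
        refine integral_mono ((hi _).indicator (ℱ.le k _ (hB k)))
          ((hi _).indicator (ℱ.le (k + 1) _ (hB (k + 1)))) fun ω ↦ ?_
        by_cases h1 : ∀ j ≤ k + 1, Y j ω < c
        · have h2 : ∀ j ≤ k, Y j ω < c := fun j hj ↦ h1 j (by omega)
          simp only [Set.indicator, Set.mem_ofPred_eq, if_pos h1, if_pos h2, le_refl]
        · by_cases h2 : ∀ j ≤ k, Y j ω < c
          · simp only [Set.indicator, Set.mem_ofPred_eq, if_neg h1, if_pos h2]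
            by_contra! h3
            refine h1 fun j hj ↦ ?_
            rcases Nat.le_succ_iff.mp hj with hj | rfl
            · exact h2 j hj
            · exact sub_pos.mp h3
          · simp only [Set.indicator, Set.mem_ofPred_eq, if_neg h1, if_neg h2, le_refl]

/-- Theorem 1, first case: collision-risk bound via a barrier certificate, as a
maximal inequality for a nonnegative supermartingale-type process. -/
theorem stmt_0
    {Ω : Type*} {m0 : MeasurableSpace Ω} {μ : Measure Ω} [IsProbabilityMeasure μ]
    (ℱ : Filtration ℕ m0) (Y : ℕ → Ω → ℝ)
    (hadapted : Adapted ℱ Y)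
    (hint : ∀ k, Integrable (Y k) μ)
    (hnonneg : ∀ k, 0 ≤ᵐ[μ] Y k)
    (γ lam : ℝ) (hγ : 0 < γ) (hlam : 0 < lam) (hγlam : γ < lam)
    (κ : ℝ) (hκ0 : 0 < κ) (hκ1 : κ < 1)
    (ψ : ℝ) (hψ : 0 ≤ ψ)
    (hcase : ψ / (1 - κ) ≤ lam)
    (h0 : ∀ᵐ ω ∂μ, Y 0 ω ≤ γ)
    (hdrift : ∀ k, ∀ᵐ ω ∂μ, (μ[Y (k + 1) | ℱ k]) ω ≤ κ * Y k ω + ψ)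
    (T : ℕ) :
    (μ {ω | ∃ k, k < T ∧ lam ≤ Y k ω}).toReal
      ≤ 1 - (1 - γ / lam) * (1 - ψ / lam) ^ T := by
  have hκa : κ ≤ 1 - ψ / lam := by
    rw [div_le_iff₀ (by linarith)] at hcase
    have : ψ / lam ≤ 1 - κ := by rw [div_le_iff₀ hlam]; linarith
    linarith
  have hψa : (1 - ψ / lam) * lam = lam - ψ := by field_simp
  have ha : 0 ≤ 1 - ψ / lam := hκ0.le.trans hκa
  set a := 1 - ψ / lam
  have hi k : Integrable (fun ω ↦ lam - Y k ω) μ := (integrable_const lam).sub (hint k)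
  have hlower k : (lam - γ) * a ^ k ≤ ∫ ω in {ω | ∀ j ≤ k, Y j ω < lam}, (lam - Y k ω) ∂μ := by
    induction k with
    | zero =>
      have hfull : {ω | ∀ j ≤ 0, Y j ω < lam} =ᵐ[μ] Set.univ := by
        refine Filter.eventuallyEq_univ.mpr ?_
        filter_upwards [h0] with ω hω j hj
        obtain rfl := Nat.le_zero.mp hj
        exact hω.trans_lt hγlam
      rw [setIntegral_congr_set hfull, setIntegral_univ]
      calc (lam - γ) * a ^ 0 = ∫ _, (lam - γ) ∂μ := by simp
        _ ≤ ∫ ω, (lam - Y 0 ω) ∂μ := by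
          refine integral_mono_ae (integrable_const _) (hi 0) ?_
          filter_upwards [h0] with ω hω
          linarith
    | succ k ih =>
      calc (lam - γ) * a ^ (k + 1) = a * ((lam - γ) * a ^ k) := by ring
        _ ≤ a * ∫ ω in {ω | ∀ j ≤ k, Y j ω < lam}, (lam - Y k ω) ∂μ :=
          mul_le_mul_of_nonneg_left ih ha
        _ ≤ _ := by
          refine mul_setIntegral_sub_le_setIntegral_sub_succ ℱ hadapted hint ?_
          filter_upwards [hdrift k, hnonneg k] with ω h1 h2
          have := mul_le_mul_of_nonneg_right hκa h2
          linarith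
  have hB := ℱ.le T _ (measurableSet_forall_le_lt ℱ hadapted lam T)
  have hupper : ∫ ω in {ω | ∀ j ≤ T, Y j ω < lam}, (lam - Y T ω) ∂μ
      ≤ μ.real {ω | ∀ j ≤ T, Y j ω < lam} * lam := by
    calc _ ≤ ∫ _ in {ω | ∀ j ≤ T, Y j ω < lam}, lam ∂μ := by
          refine setIntegral_mono_ae (hi T).integrableOn (integrable_const lam) ?_
          filter_upwards [hnonneg T] with ω hω
          exact sub_le_self lam hω
      _ = _ := by simp
  have hstay : (1 - γ / lam) * a ^ T ≤ μ.real {ω | ∀ j ≤ T, Y j ω < lam} := by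
    refine le_of_mul_le_mul_right ?_ hlam
    calc (1 - γ / lam) * a ^ T * lam = (lam - γ) * a ^ T := by field_simp
      _ ≤ _ := (hlower T).trans hupper
  calc (μ {ω | ∃ k, k < T ∧ lam ≤ Y k ω}).toReal
      ≤ μ.real {ω | ∀ j ≤ T, Y j ω < lam}ᶜ := by
        refine measureReal_mono ?_
        rintro ω ⟨k, hk, hkω⟩ hω
        exact absurd (hω k hk.le) hkω.not_gt
    _ = 1 - μ.real {ω | ∀ j ≤ T, Y j ω < lam} := probReal_compl_eq_one_sub hB
    _ ≤ _ := by linarith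
end

section
/- Let (Ω, F, P) be a probability space with a filtration (F_k)_{k∈ℕ} and let (Y_k)_{k∈ℕ} be a nonnegative real-valued stochastic process adapted to (F_k) such that each Y_k is integrable. Let γ, λ > 0 with λ > γ, let 0 < κ < 1, let ψ ≥ 0, and assume λ < ψ/(1−κ). Suppose Y_0 ≤ γ almost surely, and for every k ∈ ℕ the conditional expectation satisfies E[Y_{k+1} | F_k] ≤ κ·Y_k + ψ almost surely. Then for every finite horizon T ∈ ℕ, P(∃ k ∈ ℕ, k < T and Y_k ≥ λ) ≤ (γ/λ)·κ^T + (ψ/((1−κ)λ))·(1 − κ^T). -/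
open MeasureTheory ProbabilityTheory

/-- **Ville's maximal inequality over a finite horizon**: a nonnegative adapted process which
decreases in conditional mean up to time `T` exceeds the level `c` before `T` with probability at
most `(∫ Z 0) / c`. -/
theorem mul_measureReal_exists_le_le_integral
    {Ω : Type*} {m0 : MeasurableSpace Ω} {μ : Measure Ω} [IsFiniteMeasure μ]
    {ℱ : Filtration ℕ m0} {Z : ℕ → Ω → ℝ} (hadapted : Adapted ℱ Z)
    (hint : ∀ k, Integrable (Z k) μ) (hnonneg : ∀ k, 0 ≤ᵐ[μ] Z k) {T : ℕ}
    (hdrift : ∀ k < T, μ[Z (k + 1) | ℱ k] ≤ᵐ[μ] Z k) (c : ℝ) :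
    c * μ.real {ω | ∃ k < T, c ≤ Z k ω} ≤ ∫ ω, Z 0 ω ∂μ := by
  let A : ℕ → Set Ω := fun n => {ω | ∃ k < n, c ≤ Z k ω}
  have hA_succ (n : ℕ) : A (n + 1) = A n ∪ {ω | c ≤ Z n ω} := by
    ext ω
    simp only [A, Set.mem_ofPred_eq, Set.mem_union, Nat.lt_succ_iff_lt_or_eq, or_and_right,
      exists_or, exists_eq_left]
  have hlevel (n : ℕ) : MeasurableSet[ℱ n] {ω | c ≤ Z n ω} :=
    @measurableSet_le _ _ _ _ _ (ℱ n) _ _ _ _ _ (@measurable_const _ _ _ (ℱ n) c) (hadapted n)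
  have hA_meas (n : ℕ) : MeasurableSet[ℱ n] (A (n + 1)) := by
    induction n with
    | zero =>
      rw [hA_succ]
      have : A 0 = ∅ := by simp [A]
      rw [this, Set.empty_union]
      exact hlevel 0
    | succ n ih =>
      rw [hA_succ]
      exact MeasurableSet.union (ℱ.mono n.le_succ _ ih) (hlevel (n + 1))
  have hA_meas0 (n : ℕ) : MeasurableSet (A n) := by
    cases n with
    | zero => simp [A]
    | succ n => exact ℱ.le n _ (hA_meas n)
  have key : ∀ n ≤ T, c * μ.real (A n) + ∫ ω in (A n)ᶜ, Z n ω ∂μ ≤ ∫ ω, Z 0 ω ∂μ := by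
    intro n
    induction n with
    | zero => simp [A]
    | succ n ih =>
      intro hn
      refine le_trans ?_ (ih (by omega))
      have hcompl : MeasurableSet[ℱ n] (A (n + 1))ᶜ := (hA_meas n).compl
      have hstep : ∫ ω in (A (n + 1))ᶜ, Z (n + 1) ω ∂μ ≤ ∫ ω in (A (n + 1))ᶜ, Z n ω ∂μ := by
        rw [← setIntegral_condExp (ℱ.le n) (hint (n + 1)) hcompl]
        exact setIntegral_mono_ae integrable_condExp.integrableOn (hint n).integrableOn
          (hdrift n (by omega))
      let D : Set Ω := {ω | c ≤ Z n ω} \ A n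
      have hD : MeasurableSet D := (ℱ.le n _ (hlevel n)).diff (hA_meas0 n)
      have hAD : A (n + 1) = A n ∪ D := by rw [hA_succ, Set.union_sdiff_self]
      have hdisj : Disjoint (A n) D := Set.disjoint_sdiff_right
      have hmeas : μ.real (A (n + 1)) = μ.real (A n) + μ.real D := by
        rw [hAD, measureReal_union hdisj hD]
      have hsplit : (A n)ᶜ = (A (n + 1))ᶜ ∪ D := by
        rw [hAD]
        ext ω
        have : ω ∈ D → ω ∉ A n := fun h => h.2
        simp only [Set.mem_compl_iff, Set.mem_union]
        tauto
      have hdisj' : Disjoint (A (n + 1))ᶜ D := by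
        rw [hAD]
        exact disjoint_compl_left.mono_right Set.subset_union_right
      have hintegral : ∫ ω in (A n)ᶜ, Z n ω ∂μ
          = (∫ ω in (A (n + 1))ᶜ, Z n ω ∂μ) + ∫ ω in D, Z n ω ∂μ := by
        rw [hsplit, setIntegral_union hdisj' hD (hint n).integrableOn (hint n).integrableOn]
      have hD_le : c * μ.real D ≤ ∫ ω in D, Z n ω ∂μ :=
        setIntegral_ge_of_const_le_real hD (measure_ne_top μ D) (fun ω hω => hω.1)
          (hint n).integrableOn
      rw [hmeas, hintegral]
      linarith
  have hfinal : 0 ≤ ∫ ω in (A T)ᶜ, Z T ω ∂μ :=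
    integral_nonneg_of_ae (ae_restrict_of_ae (hnonneg T))
  linarith [key T le_rfl]

/-- Theorem 1, second case: collision-risk bound via a barrier certificate, as a
maximal inequality for a nonnegative supermartingale-type process. -/
theorem stmt_1
    {Ω : Type*} {m0 : MeasurableSpace Ω} {μ : Measure Ω} [IsProbabilityMeasure μ]
    (ℱ : Filtration ℕ m0) (Y : ℕ → Ω → ℝ)
    (hadapted : Adapted ℱ Y)
    (hint : ∀ k, Integrable (Y k) μ)
    (hnonneg : ∀ k, 0 ≤ᵐ[μ] Y k)
    (γ lam : ℝ) (hγ : 0 < γ) (hlam : 0 < lam) (hγlam : γ < lam)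
    (κ : ℝ) (hκ0 : 0 < κ) (hκ1 : κ < 1)
    (ψ : ℝ) (hψ : 0 ≤ ψ)
    (hcase : lam < ψ / (1 - κ))
    (h0 : ∀ᵐ ω ∂μ, Y 0 ω ≤ γ)
    (hdrift : ∀ k, ∀ᵐ ω ∂μ, (μ[Y (k + 1) | ℱ k]) ω ≤ κ * Y k ω + ψ)
    (T : ℕ) :
    (μ {ω | ∃ k, k < T ∧ lam ≤ Y k ω}).toReal
      ≤ (γ / lam) * κ ^ T + (ψ / ((1 - κ) * lam)) * (1 - κ ^ T) := by
  set c := ψ / (1 - κ) with hc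
  have hκ1' : 0 < 1 - κ := sub_pos.mpr hκ1
  have hψc : ψ = c * (1 - κ) := by rw [hc, div_mul_cancel₀ _ hκ1'.ne']
  have hc0 : 0 < c := hlam.trans hcase
  have hpow (n : ℕ) : 0 < κ ^ n ∧ κ ^ n ≤ 1 := ⟨pow_pos hκ0 n, pow_le_one₀ hκ0.le hκ1.le⟩
  let Z : ℕ → Ω → ℝ := fun k ω => κ ^ (T - k) * Y k ω + c * (1 - κ ^ (T - k))
  have hZint (k : ℕ) : Integrable (Z k) μ :=
    ((hint k).const_mul _).add (integrable_const _)
  have hZadapted : Adapted ℱ Z := fun k => ((hadapted k).const_mul _).add_const _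
  have hZnonneg (k : ℕ) : 0 ≤ᵐ[μ] Z k := by
    filter_upwards [hnonneg k] with ω hω
    exact add_nonneg (mul_nonneg (hpow _).1.le hω)
      (mul_nonneg hc0.le (sub_nonneg.mpr (hpow _).2))
  have hZdrift : ∀ k < T, μ[Z (k + 1) | ℱ k] ≤ᵐ[μ] Z k := by
    intro k hk
    obtain ⟨n, rfl⟩ := Nat.exists_eq_add_of_lt hk
    have e₁ : k + n + 1 - k = n + 1 := by omega
    have e₂ : k + n + 1 - (k + 1) = n := by omega
    have hZ : Z (k + 1) = κ ^ n • Y (k + 1) + fun _ => c * (1 - κ ^ n) := by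
      ext ω
      simp [Z, e₂]
    rw [hZ]
    filter_upwards [condExp_add ((hint (k + 1)).smul (κ ^ n))
      (integrable_const (c * (1 - κ ^ n))) (ℱ k),
      condExp_smul (μ := μ) (κ ^ n) (Y (k + 1)) (ℱ k), hdrift k] with ω hadd hsmul hd
    rw [hadd, Pi.add_apply, hsmul, condExp_const (ℱ.le k), Pi.smul_apply, smul_eq_mul]
    simp only [Z, e₁]
    calc κ ^ n * (μ[Y (k + 1) | ℱ k]) ω + c * (1 - κ ^ n)
        ≤ κ ^ n * (κ * Y k ω + ψ) + c * (1 - κ ^ n) := by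
          have := mul_le_mul_of_nonneg_left hd (hpow n).1.le
          linarith
      _ = κ ^ (n + 1) * Y k ω + c * (1 - κ ^ (n + 1)) := by rw [hψc]; ring
  have hsub : {ω | ∃ k, k < T ∧ lam ≤ Y k ω} ⊆ {ω | ∃ k < T, lam ≤ Z k ω} := by
    rintro ω ⟨k, hk, hY⟩
    refine ⟨k, hk, ?_⟩
    have h₁ := mul_le_mul_of_nonneg_left hY (hpow (T - k)).1.le
    have h₂ := mul_le_mul_of_nonneg_right hcase.le (sub_nonneg.mpr (hpow (T - k)).2)
    simp only [Z]
    linarith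
  have hZ0 : ∫ ω, Z 0 ω ∂μ ≤ κ ^ T * γ + c * (1 - κ ^ T) := by
    have hle : Z 0 ≤ᵐ[μ] fun _ => κ ^ T * γ + c * (1 - κ ^ T) := by
      filter_upwards [h0] with ω hω
      have := mul_le_mul_of_nonneg_left hω (hpow T).1.le
      simpa [Z] using this
    simpa using integral_mono_ae (hZint 0) (integrable_const _) hle
  have hmax := mul_measureReal_exists_le_le_integral hZadapted hZint hZnonneg hZdrift lam
  have hmono := mul_le_mul_of_nonneg_left (measureReal_mono (μ := μ) hsub) hlam.le
  have hrhs : γ / lam * κ ^ T + ψ / ((1 - κ) * lam) * (1 - κ ^ T)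
      = (κ ^ T * γ + c * (1 - κ ^ T)) / lam := by
    rw [← div_div, ← hc]
    ring
  rw [hrhs, le_div_iff₀ hlam, mul_comm]
  exact hmono.trans (hmax.trans hZ0)
end

section
/- Let M ∈ ℕ with M ≥ 1 and let n_1, …, n_M ∈ ℕ. For each i ∈ {1, …, M}, let x_i ∈ ℝ^{n_i}, let b_i ≥ 0, and let constants κ_i ∈ (0, 1), ρ_i ≥ 0, ψ_i ≥ 0, α_i > 0 be given, such that α_i·‖x_i‖² ≤ b_i (Euclidean norm). Define π_i := κ_i − 1 + Σ_{j ≠ i} ρ_j/α_i for each i, and suppose there exists π ∈ (−1, 0) with π_i < π for all i. Then Σ_{i=1}^M ( κ_i·b_i + ρ_i·Σ_{j ≠ i} ‖x_j‖² + ψ_i ) ≤ (1 + π)·Σ_{i=1}^M b_i + Σ_{i=1}^M ψ_i. -/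
/-- Off-diagonal double sums are invariant under exchanging the two indices. -/
theorem sum_sum_erase_comm {ι R : Type*} [Fintype ι] [DecidableEq ι] [AddCommMonoid R]
    (f : ι → ι → R) :
    ∑ i, ∑ j ∈ Finset.univ.erase i, f i j = ∑ i, ∑ j ∈ Finset.univ.erase i, f j i :=
  Finset.sum_comm' (by simp [eq_comm])

/-- The key small-gain algebraic inequality (chain of inequalities (17)) in the
proof of Theorem 3: `b i` plays the role of the sub-barrier value `B_i(x_i)`. -/
theorem stmt_8 (M : ℕ) (hM : 1 ≤ M) (n : Fin M → ℕ)
    (x : (i : Fin M) → Fin (n i) → ℝ)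
    (b κ ρ ψ α : Fin M → ℝ)
    (hb : ∀ i, 0 ≤ b i)
    (hκ : ∀ i, κ i ∈ Set.Ioo (0 : ℝ) 1)
    (hρ : ∀ i, 0 ≤ ρ i) (hψ : ∀ i, 0 ≤ ψ i) (hα : ∀ i, 0 < α i)
    (hlb : ∀ i, α i * ∑ k, (x i k) ^ 2 ≤ b i)
    (π : ℝ) (hπ : π ∈ Set.Ioo (-1 : ℝ) 0)
    (hπi : ∀ i, κ i - 1 + ∑ j ∈ Finset.univ.erase i, ρ j / α i < π) :
    ∑ i, (κ i * b i + ρ i * ∑ j ∈ Finset.univ.erase i, (∑ k, (x j k) ^ 2) + ψ i)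
      ≤ (1 + π) * ∑ i, b i + ∑ i, ψ i := by
  have hswap : ∑ i, ρ i * ∑ j ∈ Finset.univ.erase i, (∑ k, (x j k) ^ 2)
      = ∑ i, (∑ j ∈ Finset.univ.erase i, ρ j) * ∑ k, (x i k) ^ 2 := by
    simp only [Finset.mul_sum (Finset.univ.erase _), Finset.sum_mul (Finset.univ.erase _)]
    exact sum_sum_erase_comm fun i j => ρ i * ∑ k, (x j k) ^ 2
  rw [Finset.sum_add_distrib, Finset.sum_add_distrib, hswap, ← Finset.sum_add_distrib,
    Finset.mul_sum]
  gcongr with i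
  have hs : ∑ k, (x i k) ^ 2 ≤ b i / α i := by
    rw [le_div_iff₀' (hα i)]
    exact hlb i
  have hr : 0 ≤ ∑ j ∈ Finset.univ.erase i, ρ j := Finset.sum_nonneg fun j _ => hρ j
  have hgain := hπi i
  rw [← Finset.sum_div] at hgain
  calc κ i * b i + (∑ j ∈ Finset.univ.erase i, ρ j) * ∑ k, (x i k) ^ 2
      ≤ κ i * b i + (∑ j ∈ Finset.univ.erase i, ρ j) * (b i / α i) := by gcongr
    _ = (κ i + (∑ j ∈ Finset.univ.erase i, ρ j) / α i) * b i := by ring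
    _ ≤ (1 + π) * b i := mul_le_mul_of_nonneg_right (by linarith) (hb i)
end

section
/- Let M ∈ ℕ with M ≥ 1. For each i ∈ {1, …, M}, let X_i ⊆ ℝ^{n_i} be a measurable set with measurable subsets X_{0i} (initial set) and X_{ci} (collision set), let (V_i, μ_i) be a measurable space with a probability measure μ_i, and let W_i := Π_{j ≠ i} X_j. Let f_i : X_i × W_i × V_i → X_i be measurable, and let B_i : X_i → ℝ be a measurable nonnegative function. Suppose there exist constants γ_i, λ_i > 0, α_i > 0, ρ_i ≥ 0, ψ_i ≥ 0, κ_i ∈ (0, 1) such that: (i) α_i·‖x_i‖² ≤ B_i(x_i) for all x_i ∈ X_i; (ii) B_i(x_i) ≤ γ_i for all x_i ∈ X_{0i}; (iii) B_i(x_i) ≥ λ_i for all x_i ∈ X_{ci}; (iv) ∫_{V_i} B_i(f_i(x_i, w_i, v)) dμ_i(v) ≤ κ_i·B_i(x_i) + ρ_i·‖w_i‖² + ψ_i for all x_i ∈ X_i and all w_i ∈ W_i, where ‖w_i‖² = Σ_{j≠i} ‖x_j‖² when w_i = (x_j)_{j≠i}. Assume the compositionality conditions: Σ_{i=1}^M λ_i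 > Σ_{i=1}^M γ_i, and π_i := κ_i − 1 + Σ_{j ≠ i} ρ_j/α_i < 0 for all i. Let π ∈ (−1, 0) satisfy max_i π_i < π < 0. Define B : Π_i X_i → ℝ by B(x) := Σ_{i=1}^M B_i(x_i), define f : (Π_i X_i) × (Π_i V_i) → Π_i X_i componentwise by f(x, v)_i := f_i(x_i, (x_j)_{j≠i}, v_i), and let μ := ⊗_i μ_i be the product probability measure on Π_i V_i. Then: (a) B(x) ≤ γ := Σ_i γ_i for all x ∈ Π_i X_{0i}; (b) B(x) ≥ λ := Σ_i λ_i for all x ∈ Π_i X_{ci}, with λ > γ; and (c) ∫ B(f(x, v)) dμ(v) ≤ (1 + π)·B(x) + ψ for all x ∈ Π_i X_i, where ψ := Σ_i ψ_i and 0 < 1 + π < 1. -/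
open MeasureTheory

/-- No integrability is needed: if the sum fails to be integrable, its Bochner integral is zero. -/
lemma integral_sum_comp_eval_le {ι : Type*} [Fintype ι] {V : ι → Type*}
    [∀ i, MeasurableSpace (V i)] (μ : (i : ι) → Measure (V i)) [∀ i, IsProbabilityMeasure (μ i)]
    (g : (i : ι) → V i → ℝ) (hg : ∀ i, Measurable (g i)) (hg0 : ∀ i v, 0 ≤ g i v) :
    ∫ v : (i : ι) → V i, (∑ i, g i (v i)) ∂(Measure.pi μ) ≤ ∑ i, ∫ v, g i v ∂(μ i) := by
  by_cases hint : Integrable (fun v : (i : ι) → V i => ∑ i, g i (v i)) (Measure.pi μ)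
  · have hi : ∀ i, Integrable (fun v : (i : ι) → V i => g i (v i)) (Measure.pi μ) := by
      intro i
      refine hint.mono' ((hg i).comp (measurable_pi_apply i)).aestronglyMeasurable
        (ae_of_all _ fun v => ?_)
      rw [Real.norm_of_nonneg (hg0 i _)]
      exact Finset.single_le_sum (f := fun j => g j (v j)) (fun j _ => hg0 j _)
        (Finset.mem_univ i)
    rw [integral_finsetSum _ fun i _ => hi i]
    exact Finset.sum_le_sum fun i _ =>
      (integral_comp_eval (hg i).aestronglyMeasurable).le
  · rw [integral_undef hint]
    exact Finset.sum_nonneg fun i _ => integral_nonneg (hg0 i)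

/-- Weighted small-gain estimate: exchanging the order of summation turns row gains into
column gains, which are then absorbed using `α i * s i ≤ b i`. -/
lemma sum_gain_le {ι : Type*} [Fintype ι] [DecidableEq ι] {α ρ κ s b : ι → ℝ} {π : ℝ}
    (hα : ∀ i, 0 < α i) (hρ : ∀ i, 0 ≤ ρ i) (hb : ∀ i, 0 ≤ b i)
    (hs : ∀ i, α i * s i ≤ b i)
    (hπ : ∀ i, κ i - 1 + ∑ j ∈ Finset.univ.erase i, ρ j / α i ≤ π) :
    ∑ i, (κ i * b i + ρ i * ∑ j ∈ Finset.univ.erase i, s j) ≤ (1 + π) * ∑ i, b i := by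
  have hswap : ∑ i, ρ i * ∑ j ∈ Finset.univ.erase i, s j
      = ∑ i, (∑ j ∈ Finset.univ.erase i, ρ j) * s i := by
    simp only [Finset.mul_sum, Finset.sum_mul]
    exact Finset.sum_comm' fun i j => by simp [eq_comm]
  rw [Finset.sum_add_distrib, hswap, ← Finset.sum_add_distrib, Finset.mul_sum]
  refine Finset.sum_le_sum fun i _ => ?_
  have hsb : s i ≤ b i / α i := (le_div_iff₀' (hα i)).2 (hs i)
  have hπi := hπ i
  rw [← Finset.sum_div] at hπi
  calc κ i * b i + (∑ j ∈ Finset.univ.erase i, ρ j) * s i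
      ≤ κ i * b i + (∑ j ∈ Finset.univ.erase i, ρ j) * (b i / α i) := by
        gcongr
        exact Finset.sum_nonneg fun j _ => hρ j
    _ = (κ i + (∑ j ∈ Finset.univ.erase i, ρ j) / α i) * b i := by ring
    _ ≤ (1 + π) * b i := mul_le_mul_of_nonneg_right (by linarith) (hb i)

/-- Theorem 3: compositional construction of a barrier certificate for an
interconnected stochastic multi-agent system via small-gain reasoning.  The
conditional expectations are written as integrals against the per-agent noise
distributions, and the interconnection constraint `w_{ij} = x_j` is substituted. -/
theorem stmt_9 (M : ℕ) (hM : 1 ≤ M) (n : Fin M → ℕ)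
    (X X0 Xc : (i : Fin M) → Set (Fin (n i) → ℝ))
    (hXmeas : ∀ i, MeasurableSet (X i))
    (hX0meas : ∀ i, MeasurableSet (X0 i)) (hXcmeas : ∀ i, MeasurableSet (Xc i))
    (hX0 : ∀ i, X0 i ⊆ X i) (hXc : ∀ i, Xc i ⊆ X i)
    (V : Fin M → Type*) [∀ i, MeasurableSpace (V i)]
    (μ : (i : Fin M) → Measure (V i)) [∀ i, IsProbabilityMeasure (μ i)]
    (f : (i : Fin M) → (Fin (n i) → ℝ) →
      ((j : {j : Fin M // j ≠ i}) → Fin (n j.1) → ℝ) → V i → (Fin (n i) → ℝ))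
    (hfmeas : ∀ i, Measurable (fun q :
        (Fin (n i) → ℝ) × ((j : {j : Fin M // j ≠ i}) → Fin (n j.1) → ℝ) × V i =>
      f i q.1 q.2.1 q.2.2))
    (hf : ∀ i, ∀ x ∈ X i, ∀ w : (j : {j : Fin M // j ≠ i}) → Fin (n j.1) → ℝ,
      (∀ j, w j ∈ X j.1) → ∀ v : V i, f i x w v ∈ X i)
    (B : (i : Fin M) → (Fin (n i) → ℝ) → ℝ)
    (hBmeas : ∀ i, Measurable (B i))
    (hBnn : ∀ i, ∀ x ∈ X i, 0 ≤ B i x)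
    (γ lam α ρ ψ κ : Fin M → ℝ)
    (hγ : ∀ i, 0 < γ i) (hlam : ∀ i, 0 < lam i) (hα : ∀ i, 0 < α i)
    (hρ : ∀ i, 0 ≤ ρ i) (hψ : ∀ i, 0 ≤ ψ i) (hκ : ∀ i, κ i ∈ Set.Ioo (0 : ℝ) 1)
    (h1 : ∀ i, ∀ x ∈ X i, α i * ∑ k, (x k) ^ 2 ≤ B i x)
    (h2 : ∀ i, ∀ x ∈ X0 i, B i x ≤ γ i)
    (h3 : ∀ i, ∀ x ∈ Xc i, lam i ≤ B i x)
    (h4 : ∀ i, ∀ x ∈ X i, ∀ w : (j : {j : Fin M // j ≠ i}) → Fin (n j.1) → ℝ,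
      (∀ j, w j ∈ X j.1) →
      ∫ v, B i (f i x w v) ∂(μ i)
        ≤ κ i * B i x + ρ i * ∑ j : {j : Fin M // j ≠ i}, ∑ k, (w j k) ^ 2 + ψ i)
    (hcomp : ∑ i, γ i < ∑ i, lam i)
    (hπineg : ∀ i, κ i - 1 + ∑ j ∈ Finset.univ.erase i, ρ j / α i < 0)
    (π : ℝ) (hπ : π ∈ Set.Ioo (-1 : ℝ) 0)
    (hπi : ∀ i, κ i - 1 + ∑ j ∈ Finset.univ.erase i, ρ j / α i < π) :
    (∀ x : (i : Fin M) → Fin (n i) → ℝ, (∀ i, x i ∈ X0 i) →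
      ∑ i, B i (x i) ≤ ∑ i, γ i) ∧
    (∀ x : (i : Fin M) → Fin (n i) → ℝ, (∀ i, x i ∈ Xc i) →
      ∑ i, lam i ≤ ∑ i, B i (x i)) ∧
    (∑ i, γ i < ∑ i, lam i) ∧
    (∀ x : (i : Fin M) → Fin (n i) → ℝ, (∀ i, x i ∈ X i) →
      ∫ v : (i : Fin M) → V i,
          (∑ i, B i (f i (x i) (fun j => x j.1) (v i))) ∂(Measure.pi μ)
        ≤ (1 + π) * ∑ i, B i (x i) + ∑ i, ψ i) ∧
    (0 < 1 + π ∧ 1 + π < 1) := by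
  refine ⟨fun x hx => Finset.sum_le_sum fun i _ => h2 i _ (hx i),
    fun x hx => Finset.sum_le_sum fun i _ => h3 i _ (hx i), hcomp, fun x hx => ?_,
    by linarith [hπ.1], by linarith [hπ.2]⟩
  calc ∫ v : (i : Fin M) → V i,
          (∑ i, B i (f i (x i) (fun j => x j.1) (v i))) ∂(Measure.pi μ)
      ≤ ∑ i, ∫ v, B i (f i (x i) (fun j => x j.1) v) ∂(μ i) :=
        integral_sum_comp_eval_le μ (fun i v => B i (f i (x i) (fun j => x j.1) v))
          (fun i => (hBmeas i).comp ((hfmeas i).comp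
            (measurable_const.prodMk (measurable_const.prodMk measurable_id))))
          fun i v => hBnn i _ (hf i _ (hx i) _ (fun j => hx j.1) v)
    _ ≤ ∑ i, (κ i * B i (x i) +
          ρ i * ∑ j ∈ Finset.univ.erase i, ∑ k, (x j k) ^ 2 + ψ i) := by
        refine Finset.sum_le_sum fun i _ => ?_
        rw [Finset.sum_subtype (Finset.univ.erase i) (p := fun j => j ≠ i) (by simp)]
        exact h4 i _ (hx i) _ fun j => hx j.1
    _ ≤ (1 + π) * ∑ i, B i (x i) + ∑ i, ψ i := by
        rw [Finset.sum_add_distrib]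
        gcongr
        exact sum_gain_le hα hρ (fun i => hBnn i _ (hx i)) (fun i => h1 i _ (hx i))
          fun i => (hπi i).le
end

section
/- Let M ∈ ℕ with M ≥ 1. For each i ∈ {1, …, M}, let X_i ⊆ ℝ^{n_i} with subsets X_{0i} (initial set) and X_{ci} (collision set), let W_i := Π_{j ≠ i} X_j, let f_i : X_i × W_i → X_i, and let B_i : X_i → ℝ be a nonnegative function. Suppose there exist constants γ_i, λ_i > 0, α_i > 0, ρ_i ≥ 0, κ_i ∈ (0, 1) such that: (i) α_i·‖x_i‖² ≤ B_i(x_i) for all x_i ∈ X_i; (ii) B_i(x_i) ≤ γ_i for all x_i ∈ X_{0i}; (iii) B_i(x_i) ≥ λ_i for all x_i ∈ X_{ci}; (iv) B_i(f_i(x_i, w_i)) ≤ κ_i·B_i(x_i) + ρ_i·‖w_i‖² for all x_i ∈ X_i, w_i ∈ W_i, where ‖w_i‖² = Σ_{j≠i} ‖x_j‖² when w_i = (x_j)_{j≠i}. Assume Σ_{i=1}^M λ_i > Σ_{i=1}^M γ_i and π_i := κ_i − 1 + Σ_{j ≠ i} ρ_j/α_i < 0 for all i, and let π ∈ (−1,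 0) with max_i π_i < π < 0. Define B(x) := Σ_{i=1}^M B_i(x_i) and f(x)_i := f_i(x_i, (x_j)_{j≠i}). Then: (a) B(x) ≤ γ := Σ_i γ_i for all x ∈ Π_i X_{0i}; (b) B(x) ≥ λ := Σ_i λ_i for all x ∈ Π_i X_{ci}, with λ > γ; and (c) B(f(x)) ≤ (1 + π)·B(x) for all x ∈ Π_i X_i, where 0 < 1 + π < 1. -/
/-- Small-gain estimate: if every column of the gain matrix sums to at most `c`, then the
total of the bounds `κ i * b i + ρ i * ∑ j ≠ i, s j` is at most `c` times the total of `b`. -/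
theorem sum_smallGain_le {ι : Type*} [Fintype ι] [DecidableEq ι] {α ρ κ b s : ι → ℝ} {c : ℝ}
    (hα : ∀ i, 0 < α i) (hρ : ∀ i, 0 ≤ ρ i) (hb : ∀ i, 0 ≤ b i) (hs : ∀ i, α i * s i ≤ b i)
    (hc : ∀ i, κ i + ∑ j ∈ Finset.univ.erase i, ρ j / α i ≤ c) :
    ∑ i, (κ i * b i + ρ i * ∑ j ∈ Finset.univ.erase i, s j) ≤ c * ∑ i, b i := by
  have hswap : ∑ i, ρ i * ∑ j ∈ Finset.univ.erase i, s j
      = ∑ j, ∑ i ∈ Finset.univ.erase j, ρ i * s j := by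
    simp_rw [Finset.mul_sum]
    exact Finset.sum_comm' (by simp [eq_comm])
  rw [Finset.sum_add_distrib, hswap, ← Finset.sum_add_distrib, Finset.mul_sum]
  refine Finset.sum_le_sum fun j _ => ?_
  calc κ j * b j + ∑ i ∈ Finset.univ.erase j, ρ i * s j
      ≤ κ j * b j + ∑ i ∈ Finset.univ.erase j, ρ i / α j * b j := by
        refine add_le_add_right (Finset.sum_le_sum fun i _ => ?_) _
        calc ρ i * s j = ρ i / α j * (α j * s j) := by
              have := (hα j).ne'
              field_simp
          _ ≤ ρ i / α j * b j :=
              mul_le_mul_of_nonneg_left (hs j) (div_nonneg (hρ i) (hα j).le)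
    _ = (κ j + ∑ i ∈ Finset.univ.erase j, ρ i / α j) * b j := by
        rw [add_mul, Finset.sum_mul]
    _ ≤ c * b j := mul_le_mul_of_nonneg_right (hc j) (hb j)


/-- Deterministic compositionality theorem (Theorem 3's analogue for deterministic
multi-agent AVs): the sum of deterministic sub-barrier certificates is a barrier
certificate for the interconnection under the small-gain conditions. -/
theorem stmt_10 (M : ℕ) (hM : 1 ≤ M) (n : Fin M → ℕ)
    (X X0 Xc : (i : Fin M) → Set (Fin (n i) → ℝ))
    (hX0 : ∀ i, X0 i ⊆ X i) (hXc : ∀ i, Xc i ⊆ X i)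
    (f : (i : Fin M) → (Fin (n i) → ℝ) →
      ((j : {j : Fin M // j ≠ i}) → Fin (n j.1) → ℝ) → (Fin (n i) → ℝ))
    (hf : ∀ i, ∀ x ∈ X i, ∀ w : (j : {j : Fin M // j ≠ i}) → Fin (n j.1) → ℝ,
      (∀ j, w j ∈ X j.1) → f i x w ∈ X i)
    (B : (i : Fin M) → (Fin (n i) → ℝ) → ℝ)
    (hBnn : ∀ i, ∀ x ∈ X i, 0 ≤ B i x)
    (γ lam α ρ κ : Fin M → ℝ)
    (hγ : ∀ i, 0 < γ i) (hlam : ∀ i, 0 < lam i) (hα : ∀ i, 0 < α i)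
    (hρ : ∀ i, 0 ≤ ρ i) (hκ : ∀ i, κ i ∈ Set.Ioo (0 : ℝ) 1)
    (h1 : ∀ i, ∀ x ∈ X i, α i * ∑ k, (x k) ^ 2 ≤ B i x)
    (h2 : ∀ i, ∀ x ∈ X0 i, B i x ≤ γ i)
    (h3 : ∀ i, ∀ x ∈ Xc i, lam i ≤ B i x)
    (h4 : ∀ i, ∀ x ∈ X i, ∀ w : (j : {j : Fin M // j ≠ i}) → Fin (n j.1) → ℝ,
      (∀ j, w j ∈ X j.1) →
      B i (f i x w) ≤ κ i * B i x + ρ i * ∑ j : {j : Fin M // j ≠ i}, ∑ k, (w j k) ^ 2)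
    (hcomp : ∑ i, γ i < ∑ i, lam i)
    (hπineg : ∀ i, κ i - 1 + ∑ j ∈ Finset.univ.erase i, ρ j / α i < 0)
    (π : ℝ) (hπ : π ∈ Set.Ioo (-1 : ℝ) 0)
    (hπi : ∀ i, κ i - 1 + ∑ j ∈ Finset.univ.erase i, ρ j / α i < π) :
    (∀ x : (i : Fin M) → Fin (n i) → ℝ, (∀ i, x i ∈ X0 i) →
      ∑ i, B i (x i) ≤ ∑ i, γ i) ∧
    (∀ x : (i : Fin M) → Fin (n i) → ℝ, (∀ i, x i ∈ Xc i) →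
      ∑ i, lam i ≤ ∑ i, B i (x i)) ∧
    (∑ i, γ i < ∑ i, lam i) ∧
    (∀ x : (i : Fin M) → Fin (n i) → ℝ, (∀ i, x i ∈ X i) →
      ∑ i, B i (f i (x i) (fun j => x j.1)) ≤ (1 + π) * ∑ i, B i (x i)) ∧
    (0 < 1 + π ∧ 1 + π < 1) := by
  refine ⟨fun x hx => Finset.sum_le_sum fun i _ => h2 i _ (hx i),
    fun x hx => Finset.sum_le_sum fun i _ => h3 i _ (hx i), hcomp, fun x hx => ?_,
    by linarith [hπ.1], by linarith [hπ.2]⟩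
  calc ∑ i, B i (f i (x i) fun j => x j.1)
      ≤ ∑ i, (κ i * B i (x i) + ρ i * ∑ j ∈ Finset.univ.erase i, ∑ k, x j k ^ 2) := by
        refine Finset.sum_le_sum fun i _ => ?_
        rw [Finset.sum_subtype (Finset.univ.erase i) (p := (· ≠ i)) (by simp)]
        exact h4 i _ (hx i) _ fun j => hx j.1
    _ ≤ (1 + π) * ∑ i, B i (x i) :=
        sum_smallGain_le (b := fun i => B i (x i)) (s := fun i => ∑ k, x i k ^ 2) hα hρ
          (fun i => hBnn i _ (hx i)) (fun i => h1 i _ (hx i)) fun i => by linarith [hπi i]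
end

section
/- Let X ⊆ ℝⁿ with subsets X_0 (initial set) and X_c (collision set), let W ⊆ ℝᵖ, and let f : X × W → X. Let B : X → ℝ, and suppose there exist constants γ, λ ∈ ℝ, ρ ≥ 0 and s' ≥ 0 such that: (i) B(x) ≤ γ for all x ∈ X_0; (ii) B(x) ≥ λ for all x ∈ X_c; (iii) B(f(x, w)) ≤ B(x) + ρ·‖w‖² for all x ∈ X and w ∈ W. Let T ∈ ℕ satisfy γ + ρ·s'²·T < λ. Then for every trajectory x : ℕ → X with x(0) ∈ X_0 and x(k+1) = f(x(k), w(k)) for a sequence w : ℕ → W with ‖w(k)‖ ≤ s' for all k, it holds that x(k) ∉ X_c for every k ∈ ℕ with k < T. -/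
/-- A real sequence whose increments are bounded by `c` grows at most linearly with slope `c`. -/
theorem le_add_nat_mul_of_succ_le_add {b : ℕ → ℝ} {c : ℝ} (h : ∀ k, b (k + 1) ≤ b k + c) (k : ℕ) :
    b k ≤ b 0 + k * c := by
  induction k with
  | zero => simp
  | succ k ih =>
    push_cast
    linarith [h k]

/-- Theorem 6: deterministic finite-horizon safety guarantee from a sub-barrier
certificate with relaxed one-step condition `B(f(x,w)) ≤ B(x) + ρ‖w‖²`. -/
theorem stmt_13 {n p : ℕ}
    (X X0 Xc : Set (Fin n → ℝ)) (W : Set (Fin p → ℝ))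
    (hX0 : X0 ⊆ X) (hXc : Xc ⊆ X)
    (f : (Fin n → ℝ) → (Fin p → ℝ) → (Fin n → ℝ))
    (hf : ∀ x ∈ X, ∀ w ∈ W, f x w ∈ X)
    (B : (Fin n → ℝ) → ℝ)
    (γ lam ρ s' : ℝ) (hρ : 0 ≤ ρ) (hs' : 0 ≤ s')
    (h1 : ∀ x ∈ X0, B x ≤ γ)
    (h2 : ∀ x ∈ Xc, lam ≤ B x)
    (h3 : ∀ x ∈ X, ∀ w ∈ W, B (f x w) ≤ B x + ρ * ∑ k, (w k) ^ 2)
    (T : ℕ) (hT : γ + ρ * s' ^ 2 * T < lam)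
    (x : ℕ → Fin n → ℝ) (w : ℕ → Fin p → ℝ)
    (hx0 : x 0 ∈ X0) (hwW : ∀ k, w k ∈ W)
    (hwbnd : ∀ k, Real.sqrt (∑ i, (w k i) ^ 2) ≤ s')
    (hdyn : ∀ k, x (k + 1) = f (x k) (w k)) :
    ∀ k, k < T → x k ∉ Xc := by
  intro k hk hkc
  have hxX : ∀ j, x j ∈ X := by
    intro j
    induction j with
    | zero => exact hX0 hx0
    | succ j ih => exact hdyn j ▸ hf _ ih _ (hwW j)
  have hstep (j : ℕ) : B (x (j + 1)) ≤ B (x j) + ρ * s' ^ 2 := by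
    rw [hdyn j]
    exact (h3 _ (hxX j) _ (hwW j)).trans (by gcongr; exact (Real.sqrt_le_left hs').1 (hwbnd j))
  have hgrowth : B (x k) ≤ B (x 0) + k * (ρ * s' ^ 2) :=
    le_add_nat_mul_of_succ_le_add (b := fun j => B (x j)) hstep k
  have hkT : (k : ℝ) * (ρ * s' ^ 2) ≤ T * (ρ * s' ^ 2) := by gcongr
  linarith [h1 _ hx0, h2 _ hkc]
end
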